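/- There exists a constant c > 0 such that for all sufficiently large even n and for every perfect pairing Q of V = {0, 1, ..., n−1} (a partition of V into n/2 unordered pairs), the probability over a pairing Π sampled from the arc-pairing distribution D that Π and Q have at least n/2 − n^{1/5000} pairs in common is at most n^{−c·n^{1/1000}}. -/

import Mathlib

/-- One step of the arc-pairing process on `Z_n`: given the current spanned arc `[L, R]`
and a ternary random choice, produce the new spanned arc and the new pair. -/
def arcStep (n : ℕ) (LR : ZMod n × ZMod n) (c : Fin 3) :
    (ZMod n × ZMod n) × Sym2 (ZMod n) :=
  if c = 0 then ((LR.1 - 2, LR.2), s(LR.1 - 2, LR.1 - 1))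
  else if c = 1 then ((LR.1 - 1, LR.2 + 1), s(LR.1 - 1, LR.2 + 1))
  else ((LR.1, LR.2 + 2), s(LR.2 + 1, LR.2 + 2))

/-- The arc-pairing process after `t` random steps, driven by the choice sequence `σ`:
it starts with the pair `P₁ = (0,1)` spanning the arc `[0,1]`, and at each step adds the
pair `(L-2, L-1)`, `(L-1, R+1)` or `(R+1, R+2)` according to `σ`.  Returns the currently
spanned arc `[L, R]` together with the set of pairs produced so far. -/
def arcProcess (n : ℕ) (σ : ℕ → Fin 3) : ℕ → (ZMod n × ZMod n) × Finset (Sym2 (ZMod n))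
  | 0 => (((0 : ZMod n), (1 : ZMod n)), {s((0 : ZMod n), (1 : ZMod n))})
  | t + 1 =>
    let p := arcProcess n σ t
    let q := arcStep n p.1 (σ t)
    (q.1, insert q.2 p.2)

/-- The pairing `Π = {P₁, …, P_{n/2}}` produced by the arc-pairing process with choice
sequence `σ` (one initial pair plus `n/2 - 1` random steps); the arc-pairing distribution
`D` is the uniform distribution over the `3^{n/2 - 1}` choice sequences. -/
def arcPairing (n : ℕ) (σ : ℕ → Fin 3) : Finset (Sym2 (ZMod n)) :=
  (arcProcess n σ (n / 2 - 1)).2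

/-- `Q` is a perfect pairing of `V = Z_n`: a partition of `V` into unordered pairs. -/
def IsPerfectPairing (n : ℕ) (Q : Finset (Sym2 (ZMod n))) : Prop :=
  (∀ e ∈ Q, ¬ e.IsDiag) ∧ ∀ v : ZMod n, ∃! e, e ∈ Q ∧ v ∈ e


theorem arcProcess_congr (n : ℕ) (f g : ℕ → Fin 3) (t : ℕ) (h : ∀ s < t, f s = g s) :
    arcProcess n f t = arcProcess n g t := by
  induction t with
  | zero => rfl
  | succ t ih =>
    have h1 := ih (fun s hs => h s (by omega))
    have h2 := h t (by omega)
    simp only [arcProcess, h1, h2]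

def arcExt (m : ℕ) (σ : Fin m → Fin 3) : ℕ → Fin 3 :=
  fun t => if h : t < m then σ ⟨t, h⟩ else 0

theorem arcProcess_diff (n : ℕ) (f : ℕ → Fin 3) (t : ℕ) :
    (arcProcess n f t).1.2 - (arcProcess n f t).1.1 = ((2 * t + 1 : ℕ) : ZMod n) := by
  induction t with
  | zero => simp [arcProcess]
  | succ t ih =>
    have key : ∀ c : Fin 3, (arcStep n (arcProcess n f t).1 c).1.2
        - (arcStep n (arcProcess n f t).1 c).1.1 = ((2 * (t + 1) + 1 : ℕ) : ZMod n) := by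
      intro c
      push_cast at ih ⊢
      fin_cases c <;> simp [arcStep] <;> linear_combination ih
    exact key (f t)

def arcW (n : ℕ) (Q : Finset (Sym2 (ZMod n))) (f : ℕ → Fin 3) (t : ℕ) : ℕ :=
  2 ^ ((arcProcess n f t).2 ∩ Q).card

theorem arc_insert_le (n : ℕ) (Q P : Finset (Sym2 (ZMod n))) (e : Sym2 (ZMod n)) :
    2 ^ ((insert e P) ∩ Q).card ≤ (if e ∈ Q then 2 else 1) * 2 ^ (P ∩ Q).card := by
  split_ifs with h
  · rw [Finset.insert_inter_of_mem h, ← pow_succ']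
    exact Nat.pow_le_pow_right (by norm_num) (Finset.card_insert_le _ _)
  · rw [Finset.insert_inter_of_notMem h, one_mul]

theorem arc_step_sum (n : ℕ) (Q : Finset (Sym2 (ZMod n))) (hQ : IsPerfectPairing n Q)
    (L R : ZMod n) (h : L - 2 ≠ R + 1) :
    ∑ c : Fin 3, (if (arcStep n (L, R) c).2 ∈ Q then 2 else 1) ≤ 5 := by
  have h01 : ¬ (s(L - 2, L - 1) ∈ Q ∧ s(L - 1, R + 1) ∈ Q) := by
    rintro ⟨h0, h1⟩
    have := (hQ.2 (L - 1)).unique ⟨h0, by simp⟩ ⟨h1, by simp⟩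
    rw [Sym2.eq_iff] at this
    rcases this with ⟨a, b⟩ | ⟨a, b⟩
    · exact h (a.trans b)
    · exact h a
  have h12 : ¬ (s(L - 1, R + 1) ∈ Q ∧ s(R + 1, R + 2) ∈ Q) := by
    rintro ⟨h0, h1⟩
    have := (hQ.2 (R + 1)).unique ⟨h0, by simp⟩ ⟨h1, by simp⟩
    rw [Sym2.eq_iff] at this
    rcases this with ⟨a, b⟩ | ⟨a, b⟩
    · exact h (by linear_combination a + b)
    · exact h (by linear_combination a)
  rw [Fin.sum_univ_three]
  simp only [arcStep]
  norm_num
  split_ifs <;> first | omega | (exfalso; tauto)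

def arcF (n : ℕ) (Q : Finset (Sym2 (ZMod n))) (t : ℕ) : ℕ :=
  ∑ σ : Fin t → Fin 3, arcW n Q (arcExt t σ) t

theorem arcF_succ (n : ℕ) (Q : Finset (Sym2 (ZMod n))) (t K : ℕ)
    (hK : ∀ f : ℕ → Fin 3,
      ∑ c : Fin 3, (if (arcStep n (arcProcess n f t).1 c).2 ∈ Q then 2 else 1) ≤ K) :
    arcF n Q (t + 1) ≤ K * arcF n Q t := by
  unfold arcF
  rw [← (Fin.snocEquiv (fun _ : Fin (t + 1) => Fin 3)).sum_comp, Fintype.sum_prod_type_right,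
    Finset.mul_sum]
  refine Finset.sum_le_sum fun σ _ => ?_
  refine le_trans ?_ (Nat.mul_le_mul_right _ (hK (arcExt t σ)))
  rw [Finset.sum_mul]
  refine Finset.sum_le_sum fun c _ => ?_
  have e1 : ∀ s < t, arcExt (t + 1) (Fin.snocEquiv (fun _ : Fin (t + 1) => Fin 3) (c, σ)) s
      = arcExt t σ s := by
    intro s hs
    have hs' : s < t + 1 := by omega
    simp [arcExt, hs, hs', Fin.snoc]
  have e2 : arcExt (t + 1) (Fin.snocEquiv (fun _ : Fin (t + 1) => Fin 3) (c, σ)) t = c := by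
    simp [arcExt, Fin.snoc]
  have e3 := arcProcess_congr n _ _ t e1
  simp only [arcW, arcProcess]
  rw [e2, e3]
  exact arc_insert_le n Q _ _

theorem arcF_bound (n : ℕ) (Q : Finset (Sym2 (ZMod n))) (hQ : IsPerfectPairing n Q) (t : ℕ)
    (ht : 2 * t + 2 < n) : arcF n Q t ≤ 2 * 5 ^ t := by
  induction t with
  | zero =>
    simp only [arcF, arcW, arcProcess]
    simp only [Finset.univ_unique, Finset.sum_singleton, pow_zero, mul_one]
    calc _ ≤ 2 ^ 1 := Nat.pow_le_pow_right (by norm_num)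
            ((Finset.card_le_card Finset.inter_subset_left).trans (by simp))
      _ = 2 := by norm_num
  | succ t ih =>
    have h1 := ih (by omega)
    have h2 := arcF_succ n Q t 5 (fun f => by
      apply arc_step_sum n Q hQ
      intro h
      have hd := arcProcess_diff n f t
      have : ((2 * t + 4 : ℕ) : ZMod n) = 0 := by
        push_cast at hd ⊢
        linear_combination -hd - h
      rw [ZMod.natCast_eq_zero_iff] at this
      have := Nat.le_of_dvd (by omega) this
      omega)
    calc _ ≤ _ := h2
      _ ≤ 5 * (2 * 5 ^ t) := by gcongr
      _ = _ := by ring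

theorem arcF_last (n : ℕ) (Q : Finset (Sym2 (ZMod n))) (hQ : IsPerfectPairing n Q) (t : ℕ)
    (ht : 2 * t + 2 < n) : arcF n Q (t + 1) ≤ 12 * 5 ^ t := by
  have h1 := arcF_bound n Q hQ t ht
  have h2 := arcF_succ n Q t 6 (fun f => by
    rw [Fin.sum_univ_three]
    split_ifs <;> omega)
  omega

theorem arc_count (n m : ℕ) (Q : Finset (Sym2 (ZMod n))) (x : ℝ) :
    (({σ : Fin m → Fin 3 | x ≤ (((arcProcess n (arcExt m σ) m).2 ∩ Q).card : ℝ)} :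
      Set (Fin m → Fin 3)).ncard : ℝ) * (2 : ℝ) ^ x ≤ (arcF n Q m : ℝ) := by
  classical
  rw [Set.ncard_eq_toFinset_card']
  unfold arcF
  push_cast
  rw [← nsmul_eq_mul]
  refine le_trans (Finset.card_nsmul_le_sum _ (fun σ => (arcW n Q (arcExt m σ) m : ℝ)) _ ?_)
    (Finset.sum_le_sum_of_subset_of_nonneg (Finset.subset_univ _) (fun _ _ _ => by positivity))
  intro σ hσ
  simp only [Set.mem_toFinset, Set.mem_setOf_eq] at hσ
  simp only [arcW]
  push_cast
  rw [← Real.rpow_natCast]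
  exact Real.rpow_le_rpow_of_exponent_le (by norm_num) hσ

theorem arc_analytic (n t : ℕ) (hn : n = 2 * t + 4) (hN : 96 ^ 4 ≤ n) :
    12 * (5 : ℝ) ^ t ≤ (n : ℝ) ^ (-(1 * (n : ℝ) ^ ((1 : ℝ) / 1000))) * 3 ^ (t + 1) *
      (2 : ℝ) ^ ((n : ℝ) / 2 - (n : ℝ) ^ ((1 : ℝ) / 5000)) := by
  have hNR : (96 : ℝ) ^ 4 ≤ n := by exact_mod_cast hN
  have hn1 : (1 : ℝ) ≤ n := by linarith [show (1 : ℝ) ≤ 96 ^ 4 by norm_num]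
  have hn0 : (0 : ℝ) < n := by linarith
  have hnR : (n : ℝ) = 2 * t + 4 := by exact_mod_cast hn
  obtain ⟨y, hy⟩ : ∃ y : ℝ, y = (n : ℝ) ^ ((1 : ℝ) / 4) := ⟨_, rfl⟩
  have hy0 : 0 < y := hy ▸ Real.rpow_pos_of_pos hn0 _
  have hy4 : y ^ 4 = n := by
    rw [hy, ← Real.rpow_natCast, ← Real.rpow_mul hn0.le]; norm_num
  have hy96 : 96 ≤ y := by
    by_contra hlt
    push Not at hlt
    have : y ^ 4 < 96 ^ 4 := pow_lt_pow_left₀ hlt hy0.le (by norm_num)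
    linarith
  have ha : (n : ℝ) ^ ((1 : ℝ) / 1000) ≤ y := by
    rw [hy]; exact Real.rpow_le_rpow_of_exponent_le hn1 (by norm_num)
  have hk : (n : ℝ) ^ ((1 : ℝ) / 5000) ≤ y := by
    rw [hy]; exact Real.rpow_le_rpow_of_exponent_le hn1 (by norm_num)
  have hlog : Real.log n ≤ 2 * y ^ 2 := by
    have := Real.log_le_rpow_div hn0.le (show (0 : ℝ) < 1 / 2 by norm_num)
    have e : (n : ℝ) ^ ((1 : ℝ) / 2) = y ^ 2 := by
      rw [hy, ← Real.rpow_natCast, ← Real.rpow_mul hn0.le]; norm_num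
    rw [e] at this
    linarith
  have hlog0 : 0 ≤ Real.log n := Real.log_nonneg hn1
  have hl2 : Real.log 2 ≤ 1 := by linarith [Real.log_two_lt_d9]
  have hl20 : 0 < Real.log 2 := Real.log_pos (by norm_num)
  have h65 : (1 : ℝ) / 6 ≤ Real.log 2 + Real.log 3 - Real.log 5 := by
    have := Real.one_sub_inv_le_log_of_pos (show (0 : ℝ) < 6 / 5 by norm_num)
    rw [Real.log_div (by norm_num) (by norm_num), show (6 : ℝ) = 2 * 3 by norm_num,
      Real.log_mul (by norm_num) (by norm_num)] at this
    norm_num at this ⊢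
    linarith
  have h12 : Real.log 12 = 2 * Real.log 2 + Real.log 3 := by
    rw [show (12 : ℝ) = 2 ^ 2 * 3 by norm_num, Real.log_mul (by norm_num) (by norm_num),
      Real.log_pow]
    norm_num
  rw [← Real.log_le_log_iff (by positivity) (by positivity),
    Real.log_mul (by positivity) (by positivity), Real.log_mul (by positivity) (by positivity),
    Real.log_mul (by positivity) (by positivity), Real.log_rpow hn0, Real.log_rpow (by norm_num),
    Real.log_pow, Real.log_pow, h12]
  push_cast
  have hA : (n : ℝ) ^ ((1 : ℝ) / 1000) * Real.log n ≤ y * (2 * y ^ 2) := by gcongr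
  have hB : (n : ℝ) ^ ((1 : ℝ) / 5000) * Real.log 2 ≤ y * 1 := by gcongr
  have ht : (t : ℝ) * (1 / 6) ≤ t * (Real.log 2 + Real.log 3 - Real.log 5) := by gcongr
  have hfin : y * (2 * y ^ 2) + y * 1 ≤ (t : ℝ) * (1 / 6) := by
    have : (t : ℝ) = y ^ 4 / 2 - 2 := by linarith
    rw [this]
    have h3 : 96 * y ^ 3 ≤ y ^ 4 := by nlinarith [pow_pos hy0 3]
    have h2 : y ≤ y ^ 3 := by nlinarith [pow_pos hy0 2]
    nlinarith
  rw [hnR] at *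
  nlinarith

/-- there is a constant `c > 0` such that for all sufficiently large even `n`
and every perfect pairing `Q` of `{0, …, n-1}`, the probability over `Π ~ D` (uniform over
the `3^{n/2-1}` ternary choice sequences) that `Π` and `Q` share at least
`n/2 - n^{1/5000}` pairs is at most `n^{-c·n^{1/1000}}`. -/
theorem arc_pairing_similarity_bound :
    ∃ c : ℝ, 0 < c ∧ ∃ N : ℕ, ∀ n : ℕ, N ≤ n → Even n →
      ∀ Q : Finset (Sym2 (ZMod n)), IsPerfectPairing n Q →
        (({σ : Fin (n / 2 - 1) → Fin 3 |
            (n : ℝ) / 2 - (n : ℝ) ^ ((1 : ℝ) / 5000) ≤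
              ((arcPairing n (fun t => if h : t < n / 2 - 1 then σ ⟨t, h⟩ else 0) ∩
                  Q).card : ℝ)} : Set (Fin (n / 2 - 1) → Fin 3)).ncard : ℝ) ≤
          (n : ℝ) ^ (-(c * (n : ℝ) ^ ((1 : ℝ) / 1000))) * 3 ^ (n / 2 - 1) := by
  refine ⟨1, one_pos, 96 ^ 4, fun n hN hev Q hQ => ?_⟩
  obtain ⟨t, ht⟩ : ∃ t, n = 2 * t + 4 := by
    obtain ⟨r, hr⟩ := hev
    exact ⟨r - 2, by omega⟩
  have hm : n / 2 - 1 = t + 1 := by omega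
  have h1 := arc_count n (n / 2 - 1) Q ((n : ℝ) / 2 - (n : ℝ) ^ ((1 : ℝ) / 5000))
  have h2 : (arcF n Q (n / 2 - 1) : ℝ) ≤ 12 * 5 ^ t := by
    rw [hm]
    exact_mod_cast arcF_last n Q hQ t (by omega)
  have h3 := arc_analytic n t ht hN
  rw [← hm] at h3
  have h4 := (h1.trans h2).trans h3
  exact le_of_mul_le_mul_right h4 (by positivity)
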